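/- Let p_X be a probability measure on ℝ with finite second moment, and let R, R_c ∈ [0,∞]. Then the map P ↦ D(R,R_c,P|W₂²) is continuous on [0,∞], i.e., it is continuous at every P ∈ [0,∞) and lim_{P→∞} D(R,R_c,P|W₂²) = D(R,R_c,∞|W₂²). -/

import Mathlib

open MeasureTheory ProbabilityTheory Real Set
open scoped ENNReal NNReal

noncomputable section

open Classical in
/-- Kullback-Leibler divergence of `q` from `p`, in `[0,∞]`. -/
def KLD {α : Type*} [MeasurableSpace α] (q p : Measure α) : ℝ≥0∞ :=
  if q ≪ p ∧ Integrable (fun x => Real.log (q.rnDeriv p x).toReal) q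
  then ENNReal.ofReal (∫ x, Real.log (q.rnDeriv p x).toReal ∂q) else ⊤

/-- Mutual information between `f` and `g` under `μ`. -/
def mutInfo {Ω α β : Type*} [MeasurableSpace Ω] [MeasurableSpace α] [MeasurableSpace β]
    (μ : Measure Ω) (f : Ω → α) (g : Ω → β) : ℝ≥0∞ :=
  KLD (μ.map (fun ω => (f ω, g ω))) ((μ.map f).prod (μ.map g))

/-- Squared Wasserstein-2 distance. -/
def W2sq (p q : Measure ℝ) : ℝ≥0∞ :=
  ⨅ (cpl : Measure (ℝ × ℝ)) (_ : IsProbabilityMeasure cpl) (_ : cpl.map Prod.fst = p)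
    (_ : cpl.map Prod.snd = q), ∫⁻ xy, ENNReal.ofReal ((xy.1 - xy.2) ^ 2) ∂cpl

/-- `exp(-x)` for `x ∈ [0,∞]`, with `exp(-∞) = 0`. -/
def expNeg (x : ℝ≥0∞) : ℝ := if x = ⊤ then 0 else Real.exp (-x.toReal)

/-- Feasibility predicate for the distortion-rate-perception function. -/
def DRPfeasible (pX : Measure ℝ) (φ : Measure ℝ → Measure ℝ → ℝ≥0∞) (R Rc P : ℝ≥0∞)
    (μ : Measure (ℝ × ℝ × ℝ)) : Prop :=
  ∃ hμ : IsProbabilityMeasure μ,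
    μ.map (fun w => w.1) = pX ∧
    (haveI := hμ
     CondIndepFun (MeasurableSpace.comap (fun w : ℝ × ℝ × ℝ => w.2.1) inferInstance)
      ((measurable_fst.comp measurable_snd).comap_le)
      (fun w : ℝ × ℝ × ℝ => w.1) (fun w : ℝ × ℝ × ℝ => w.2.2) μ) ∧
    mutInfo μ (fun w => w.1) (fun w => w.2.1) ≤ R ∧
    mutInfo μ (fun w => w.2.2) (fun w => w.2.1) ≤ R + Rc ∧
    φ pX (μ.map (fun w => w.2.2)) ≤ P

/-- Mean squared distortion of a joint law of `(X, U, X̂)`. -/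
def distortion (μ : Measure (ℝ × ℝ × ℝ)) : ℝ≥0∞ :=
  ∫⁻ w, ENNReal.ofReal ((w.1 - w.2.2) ^ 2) ∂μ

/-- The distortion-rate-perception function `D(R, R_c, P | φ)`. -/
def DRP (pX : Measure ℝ) (φ : Measure ℝ → Measure ℝ → ℝ≥0∞) (R Rc P : ℝ≥0∞) : ℝ≥0∞ :=
  ⨅ (μ : Measure (ℝ × ℝ × ℝ)) (_ : DRPfeasible pX φ R Rc P μ), distortion μ

/-- `D(R, R_c, ∞)`: the DRP function without perception constraint. -/
def DRPinf (pX : Measure ℝ) (R Rc : ℝ≥0∞) : ℝ≥0∞ :=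
  DRP pX (fun _ _ => 0) R Rc ⊤

/-- Deterministic-decoder (entropy-constrained quantization) function `D_e(R, R_c)`,
with `H(X̂) := I(X̂; X̂)`. -/
def De (pX : Measure ℝ) (R Rc : ℝ≥0∞) : ℝ≥0∞ :=
  ⨅ (cpl : Measure (ℝ × ℝ)) (_ : IsProbabilityMeasure cpl ∧ cpl.map Prod.fst = pX ∧
      mutInfo cpl Prod.fst Prod.snd ≤ R ∧ mutInfo cpl Prod.snd Prod.snd ≤ R + Rc),
    ∫⁻ w, ENNReal.ofReal ((w.1 - w.2) ^ 2) ∂cpl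

/-- The Gaussian measure `N(μ, σ²)`. -/
def gauss (μ σ : ℝ) : Measure ℝ := gaussianReal μ ⟨σ ^ 2, sq_nonneg σ⟩

end
noncomputable section

/-- `ξ(R, R_c) = √((1 - e^{-2R})(1 - e^{-2(R+R_c)}))`. -/
def xiRRc (R Rc : ℝ≥0∞) : ℝ :=
  Real.sqrt ((1 - expNeg (2 * R)) * (1 - expNeg (2 * (R + Rc))))

/-- `ψ(σ) = log(σ_X/σ) + (σ² - σ_X²)/(2σ_X²)`. -/
def psi (σX s : ℝ) : ℝ := Real.log (σX / s) + (s ^ 2 - σX ^ 2) / (2 * σX ^ 2)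

/-- `δ₊(σ̂, α)` from the improved lower bound. -/
def deltaPlus (σX : ℝ) (R Rc : ℝ≥0∞) (P s α : ℝ) : ℝ :=
  max (σX * expNeg (R + Rc) -
    Real.sqrt (σX ^ 2 - α * (σX ^ 2 + s ^ 2 - P) + α ^ 2 * s ^ 2)) 0 / α

/-- The inner `sup` over `α > 0` in the improved lower bound `D̲'`. -/
def DlowerPrimeFun (σX : ℝ) (R Rc : ℝ≥0∞) (P s : ℝ) : ℝ :=
  sSup ((fun α => σX ^ 2 + s ^ 2 - 2 * σX *
    Real.sqrt ((1 - expNeg (2 * R)) * (s ^ 2 - deltaPlus σX R Rc P s α ^ 2))) '' Set.Ioi 0)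

/-- The improved explicit lower bound `D̲'(R, R_c, P | W₂²)`. -/
def DlowerPrime (σX : ℝ) (R Rc : ℝ≥0∞) (P : ℝ) : ℝ :=
  sInf (DlowerPrimeFun σX R Rc P '' Set.Icc (max (σX - Real.sqrt P) 0) σX)

/-- The explicit lower bound `D̲(R, R_c, P | W₂²)` of Xie et al. -/
def DlowerW2 (σX : ℝ) (R Rc : ℝ≥0∞) (P : ℝ) : ℝ :=
  sInf ((fun s => σX ^ 2 + s ^ 2 - 2 * σX *
      Real.sqrt ((1 - expNeg (2 * R)) *
        (s ^ 2 - max (σX * expNeg (R + Rc) - Real.sqrt P) 0 ^ 2)))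
    '' Set.Icc (max (σX - Real.sqrt P) 0) σX)

end

open Filter Topology InformationTheory in
lemma KLD_eq_klDiv {α : Type*} [MeasurableSpace α] (q p : Measure α) [IsProbabilityMeasure q]
    [IsProbabilityMeasure p] : KLD q p = klDiv q p := by
  classical
  rw [klDiv_def, KLD]
  have : llr q p = fun x => Real.log (q.rnDeriv p x).toReal := rfl
  simp [this]

/-- The kernel replacing the third coordinate by a sample of `η`. -/
noncomputable def thirdK (η : Kernel ℝ ℝ) : Kernel (ℝ × ℝ × ℝ) (ℝ × ℝ × ℝ) :=
  Kernel.id ∥ₖ (Kernel.id ∥ₖ η)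

instance (η : Kernel ℝ ℝ) [IsMarkovKernel η] : IsMarkovKernel (thirdK η) := by
  unfold thirdK; infer_instance

lemma thirdK_apply (η : Kernel ℝ ℝ) [IsMarkovKernel η] (w : ℝ × ℝ × ℝ) :
    thirdK η w = (η w.2.2).map (fun z => (w.1, w.2.1, z)) := by
  rw [thirdK, Kernel.parallelComp_apply, Kernel.parallelComp_apply]
  simp only [Kernel.id_apply, Measure.dirac_prod]
  rw [Measure.map_map (by fun_prop) (by fun_prop)]
  rfl

lemma thirdK_map {γ : Type*} [MeasurableSpace γ] (η : Kernel ℝ ℝ) [IsMarkovKernel η]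
    (μ : Measure (ℝ × ℝ × ℝ)) {f : ℝ × ℝ × ℝ → γ} (hf : Measurable f)
    {δ : Type*} [MeasurableSpace δ] {g : ℝ × ℝ × ℝ → δ} (hg : Measurable g) (K : Kernel δ γ)
    (h : ∀ w, (η w.2.2).map (fun z => f (w.1, w.2.1, z)) = K (g w)) :
    (thirdK η ∘ₘ μ).map f = K ∘ₘ (μ.map g) := by
  rw [← Measure.deterministic_comp_eq_map hf, ← Measure.deterministic_comp_eq_map hg,
    Measure.comp_assoc, Measure.comp_assoc]
  congr 1
  ext1 w
  rw [Kernel.deterministic_comp_eq_map, Kernel.comp_deterministic_eq_comap, Kernel.map_apply _ hf,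
    Kernel.comap_apply, ← h w, thirdK_apply, Measure.map_map hf (by fun_prop)]
  rfl

lemma thirdK_map_eq {γ : Type*} [MeasurableSpace γ] (η : Kernel ℝ ℝ) [IsMarkovKernel η]
    (μ : Measure (ℝ × ℝ × ℝ)) {f : ℝ × ℝ × ℝ → γ} (hf : Measurable f)
    (h : ∀ w z, f (w.1, w.2.1, z) = f w) :
    (thirdK η ∘ₘ μ).map f = μ.map f := by
  rw [thirdK_map η μ hf hf Kernel.id, Measure.id_comp]
  intro w
  simp [h w, Kernel.id_apply, Measure.map_const]

lemma thirdK_condIndep (η : Kernel ℝ ℝ) [IsMarkovKernel η] (μ : Measure (ℝ × ℝ × ℝ))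
    [IsProbabilityMeasure μ]
    (h : CondIndepFun (MeasurableSpace.comap (fun w : ℝ × ℝ × ℝ => w.2.1) inferInstance)
      ((measurable_fst.comp measurable_snd).comap_le)
      (fun w : ℝ × ℝ × ℝ => w.1) (fun w : ℝ × ℝ × ℝ => w.2.2) μ) :
    CondIndepFun (MeasurableSpace.comap (fun w : ℝ × ℝ × ℝ => w.2.1) inferInstance)
      ((measurable_fst.comp measurable_snd).comap_le)
      (fun w : ℝ × ℝ × ℝ => w.1) (fun w : ℝ × ℝ × ℝ => w.2.2) (thirdK η ∘ₘ μ) := by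
  have hf : Measurable (fun w : ℝ × ℝ × ℝ => w.1) := by fun_prop
  have hg : Measurable (fun w : ℝ × ℝ × ℝ => w.2.2) := by fun_prop
  have hk : Measurable (fun w : ℝ × ℝ × ℝ => w.2.1) := by fun_prop
  rw [condIndepFun_iff_map_prod_eq_prod_condDistrib_prod_condDistrib hf hg hk] at h ⊢
  set a := condDistrib (fun w : ℝ × ℝ × ℝ => w.1) (fun w => w.2.1) μ with ha
  set b := condDistrib (fun w : ℝ × ℝ × ℝ => w.2.2) (fun w => w.2.1) μ with hb
  have hkk : (thirdK η ∘ₘ μ).map (fun w => w.2.1) = μ.map (fun w => w.2.1) :=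
    thirdK_map_eq η μ hk (by simp)
  have e1 : condDistrib (fun w : ℝ × ℝ × ℝ => w.1) (fun w => w.2.1) (thirdK η ∘ₘ μ)
      =ᵐ[μ.map (fun w => w.2.1)] a := by
    rw [← hkk]
    apply condDistrib_ae_eq_of_measure_eq_compProd _ hf.aemeasurable
    rw [hkk, thirdK_map_eq η μ (by fun_prop) (by simp), ha,
      compProd_map_condDistrib hf.aemeasurable]
  have e2 : condDistrib (fun w : ℝ × ℝ × ℝ => w.2.2) (fun w => w.2.1) (thirdK η ∘ₘ μ)
      =ᵐ[μ.map (fun w => w.2.1)] (η ∘ₖ b) := by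
    rw [← hkk]
    apply condDistrib_ae_eq_of_measure_eq_compProd _ hg.aemeasurable
    rw [hkk, ← Measure.parallelComp_comp_compProd, hb, compProd_map_condDistrib hg.aemeasurable]
    apply thirdK_map η μ (by fun_prop) (by fun_prop)
    intro w
    rw [Kernel.parallelComp_apply, Kernel.id_apply, Measure.dirac_prod]
  rw [hkk]
  have e3 : (thirdK η ∘ₘ μ).map (fun w => (w.2.1, w.1, w.2.2)) =
      (Kernel.id ∥ₖ (Kernel.id ∥ₖ η)) ∘ₘ (μ.map (fun w => (w.2.1, w.1, w.2.2))) := by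
    apply thirdK_map η μ (by fun_prop) (by fun_prop)
    intro w
    change _ = thirdK η _
    rw [thirdK_apply]
  rw [e3, h, Measure.comp_assoc, Kernel.parallelComp_comp_prod, Kernel.parallelComp_comp_prod,
    Kernel.id_comp, Kernel.id_comp]
  apply Measure.bind_congr_right
  filter_upwards [e1, e2] with x h1 h2
  rw [Kernel.prod_apply, Kernel.prod_apply, Kernel.prod_apply, Kernel.prod_apply, h1, h2]

open InformationTheory in
lemma thirdK_mutInfo (η : Kernel ℝ ℝ) [IsMarkovKernel η] (μ : Measure (ℝ × ℝ × ℝ))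
    [IsProbabilityMeasure μ] :
    mutInfo (thirdK η ∘ₘ μ) (fun w => w.2.2) (fun w => w.2.1) ≤
      mutInfo μ (fun w => w.2.2) (fun w => w.2.1) := by
  unfold mutInfo
  have hg : Measurable (fun w : ℝ × ℝ × ℝ => w.2.2) := by fun_prop
  have hk : Measurable (fun w : ℝ × ℝ × ℝ => w.2.1) := by fun_prop
  have hgk : Measurable (fun w : ℝ × ℝ × ℝ => (w.2.2, w.2.1)) := by fun_prop
  have := Measure.isProbabilityMeasure_map (μ := thirdK η ∘ₘ μ) hg.aemeasurable
  have := Measure.isProbabilityMeasure_map (μ := thirdK η ∘ₘ μ) hk.aemeasurable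
  have := Measure.isProbabilityMeasure_map (μ := thirdK η ∘ₘ μ) hgk.aemeasurable
  have := Measure.isProbabilityMeasure_map (μ := μ) hg.aemeasurable
  have := Measure.isProbabilityMeasure_map (μ := μ) hk.aemeasurable
  have := Measure.isProbabilityMeasure_map (μ := μ) hgk.aemeasurable
  rw [KLD_eq_klDiv, KLD_eq_klDiv]
  have e1 : (thirdK η ∘ₘ μ).map (fun w => (w.2.2, w.2.1)) =
      (η ∥ₖ Kernel.id) ∘ₘ (μ.map (fun w => (w.2.2, w.2.1))) := by
    apply thirdK_map η μ hgk hgk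
    intro w
    rw [Kernel.parallelComp_apply, Kernel.id_apply, Measure.prod_dirac]
  have e2 : (thirdK η ∘ₘ μ).map (fun w => w.2.2) = η ∘ₘ (μ.map (fun w => w.2.2)) := by
    apply thirdK_map η μ hg hg
    intro w
    simp
  rw [e1, e2, thirdK_map_eq η μ hk (by simp), Measure.prod_comp_left]
  exact klDiv_comp_right_le _ _ _

lemma ofReal_sq_eq_rpow (x : ℝ) : ENNReal.ofReal (x ^ 2) = (‖x‖ₑ) ^ (2 : ℝ) := by
  rw [← sq_abs, ENNReal.ofReal_pow (abs_nonneg _), ← Real.norm_eq_abs, ofReal_norm]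
  norm_cast

lemma key_step (pX : Measure ℝ) (R Rc P P' : ℝ≥0∞) (μ : Measure (ℝ × ℝ × ℝ))
    (hμ : DRPfeasible pX W2sq R Rc P' μ) (c : Measure (ℝ × ℝ)) [IsProbabilityMeasure c]
    (hc1 : c.map Prod.fst = pX) (hc2 : c.map Prod.snd = μ.map (fun w => w.2.2))
    (t : ℝ≥0)
    (hP : ENNReal.ofReal ((1 - t : ℝ) ^ 2) *
      ∫⁻ xy, ENNReal.ofReal ((xy.1 - xy.2) ^ 2) ∂c ≤ P) :
    DRP pX W2sq R Rc P ^ (1 / 2 : ℝ) ≤ distortion μ ^ (1 / 2 : ℝ) +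
      t * (∫⁻ xy, ENNReal.ofReal ((xy.1 - xy.2) ^ 2) ∂c) ^ (1 / 2 : ℝ) := by
  obtain ⟨hμp, h1, h2, h3, h4, -⟩ := hμ
  let m : ℝ × ℝ → ℝ := fun p => (1 - t) * p.1 + t * p.2
  have hm : Measurable m := by fun_prop
  let cs := c.map Prod.swap
  have hcs : IsProbabilityMeasure cs := Measure.isProbabilityMeasure_map (by fun_prop)
  have hfst : cs.fst = μ.map (fun w => w.2.2) := by
    rw [← hc2, Measure.fst, Measure.map_map (by fun_prop) (by fun_prop)]; rfl
  let κ := cs.condKernel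
  have hdis : (μ.map (fun w => w.2.2)) ⊗ₘ κ = cs := by
    rw [← hfst]; exact cs.disintegrate cs.condKernel
  let η : Kernel ℝ ℝ := (Kernel.id ×ₖ κ).map m
  have : IsMarkovKernel η := Kernel.IsMarkovKernel.map _ hm
  have hη : ∀ x, η x = (κ x).map (fun y => m (x, y)) := by
    intro x
    rw [Kernel.map_apply _ hm, Kernel.prod_apply, Kernel.id_apply, Measure.dirac_prod,
      Measure.map_map hm (by fun_prop)]
    rfl
  have hηq : η ∘ₘ (μ.map (fun w => w.2.2)) = cs.map m := by
    rw [← Measure.map_comp _ _ hm, ← Measure.compProd_eq_comp_prod, hdis]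
  have hmap2 : (thirdK η ∘ₘ μ).map (fun w => w.2.2) = cs.map m := by
    rw [← hηq]
    apply thirdK_map η μ (by fun_prop) (by fun_prop)
    intro w
    simp
  have hfeas : DRPfeasible pX W2sq R Rc P (thirdK η ∘ₘ μ) := by
    refine ⟨inferInstance, ?_, thirdK_condIndep η μ h2, ?_, (thirdK_mutInfo η μ).trans h4, ?_⟩
    · rw [thirdK_map_eq η μ (by fun_prop) (by simp), h1]
    · unfold mutInfo at h3 ⊢
      rwa [thirdK_map_eq η μ (by fun_prop) (by simp), thirdK_map_eq η μ (by fun_prop) (by simp),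
        thirdK_map_eq η μ (by fun_prop) (by simp)]
    · refine le_trans ?_ hP
      rw [hmap2]
      unfold W2sq
      have hM : Measurable (fun p : ℝ × ℝ => (p.1, m p.swap)) := by fun_prop
      refine (iInf_le _ (c.map (fun p => (p.1, m p.swap)))).trans ?_
      refine (iInf_le _ (Measure.isProbabilityMeasure_map hM.aemeasurable)).trans ?_
      refine (iInf_le _ ?_).trans ((iInf_le _ ?_).trans ?_)
      · rw [Measure.map_map measurable_fst hM, ← hc1]; rfl
      · rw [Measure.map_map measurable_snd hM, Measure.map_map hm measurable_swap]; rfl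
      · rw [lintegral_map (by fun_prop) hM, ← lintegral_const_mul _ (by fun_prop)]
        apply lintegral_mono
        intro p
        simp only
        rw [← ENNReal.ofReal_mul (sq_nonneg _)]
        apply ENNReal.ofReal_le_ofReal
        apply le_of_eq
        simp only [m, Prod.swap]
        ring
  have hD : DRP pX W2sq R Rc P ≤ distortion (thirdK η ∘ₘ μ) :=
    iInf₂_le (thirdK η ∘ₘ μ) hfeas
  refine (ENNReal.rpow_le_rpow hD (by norm_num)).trans ?_
  have h22 : Measurable (fun w : ℝ × ℝ × ℝ => w.2.2) := by fun_prop
  let ν := μ ⊗ₘ (κ.comap (fun w : ℝ × ℝ × ℝ => w.2.2) h22)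
  have hd : distortion (thirdK η ∘ₘ μ) =
      ∫⁻ p, ENNReal.ofReal ((p.1.1 - m (p.1.2.2, p.2)) ^ 2) ∂ν := by
    unfold distortion
    rw [Measure.lintegral_bind (by fun_prop) (by fun_prop),
      Measure.lintegral_compProd (by fun_prop)]
    congr 1
    ext w
    rw [thirdK_apply, lintegral_map (by fun_prop) (by fun_prop), hη, Kernel.comap_apply,
      lintegral_map (by fun_prop) (by fun_prop)]
  have hd1 : distortion μ = ∫⁻ p, ‖p.1.1 - p.1.2.2‖ₑ ^ (2 : ℝ) ∂ν := by
    unfold distortion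
    rw [Measure.lintegral_compProd (by fun_prop)]
    simp [ofReal_sq_eq_rpow]
  have hd2 : ∫⁻ xy, ENNReal.ofReal ((xy.1 - xy.2) ^ 2) ∂c =
      ∫⁻ p, ‖p.1.2.2 - p.2‖ₑ ^ (2 : ℝ) ∂ν := by
    rw [Measure.lintegral_compProd (by fun_prop)]
    have : ∫⁻ xy, ENNReal.ofReal ((xy.1 - xy.2) ^ 2) ∂c =
        ∫⁻ xy, ‖xy.1 - xy.2‖ₑ ^ (2 : ℝ) ∂cs := by
      rw [lintegral_map (by fun_prop) (by fun_prop)]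
      congr 1
      ext p
      rw [← ofReal_sq_eq_rpow]
      congr 1
      simp only [Prod.swap]
      ring
    rw [this, ← hdis, Measure.lintegral_compProd (by fun_prop), lintegral_map _ h22]
    · rfl
    · exact Measurable.lintegral_kernel_prod_right' (κ := κ)
        (f := fun p : ℝ × ℝ => ‖p.1 - p.2‖ₑ ^ (2 : ℝ)) (by fun_prop)
  rw [hd, hd1, hd2]
  have hmink := ENNReal.lintegral_Lp_add_le (μ := ν) (p := 2)
    (f := fun p => ‖p.1.1 - p.1.2.2‖ₑ) (g := fun p => t * ‖p.1.2.2 - p.2‖ₑ)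
    (by fun_prop) (by fun_prop) (by norm_num)
  refine le_trans ?_ (hmink.trans (add_le_add le_rfl ?_))
  · apply ENNReal.rpow_le_rpow _ (by norm_num)
    apply lintegral_mono
    intro p
    simp only [Pi.add_apply]
    rw [ofReal_sq_eq_rpow]
    apply ENNReal.rpow_le_rpow _ (by norm_num)
    have e : p.1.1 - m (p.1.2.2, p.2) = (p.1.1 - p.1.2.2) + (t : ℝ) * (p.1.2.2 - p.2) := by
      simp only [m]; ring
    rw [e]
    refine (enorm_add_le _ _).trans (add_le_add le_rfl ?_)
    rw [enorm_mul]
    simp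
  · simp_rw [ENNReal.mul_rpow_of_nonneg _ _ (by norm_num : (0 : ℝ) ≤ 2)]
    rw [lintegral_const_mul _ (by fun_prop), ENNReal.mul_rpow_of_nonneg _ _ (by norm_num),
      ← ENNReal.rpow_mul]
    norm_num

lemma DRP_antitone (pX : Measure ℝ) (R Rc : ℝ≥0∞) {P P' : ℝ≥0∞} (h : P ≤ P') :
    DRP pX W2sq R Rc P' ≤ DRP pX W2sq R Rc P := by
  unfold DRP
  refine le_iInf₂ fun μ hμ => iInf₂_le μ ?_
  obtain ⟨a, b, c, d, e, f⟩ := hμ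
  exact ⟨a, b, c, d, e, f.trans h⟩

lemma DRP_lip (pX : Measure ℝ) (R Rc : ℝ≥0∞) {s s' : ℝ≥0} (h : s ≤ s') :
    DRP pX W2sq R Rc ((s : ℝ≥0∞) ^ 2) ^ (1 / 2 : ℝ) ≤
      DRP pX W2sq R Rc ((s' : ℝ≥0∞) ^ 2) ^ (1 / 2 : ℝ) + ((s' - s : ℝ≥0) : ℝ≥0∞) := by
  have main : ∀ μ, DRPfeasible pX W2sq R Rc ((s' : ℝ≥0∞) ^ 2) μ →
      DRP pX W2sq R Rc ((s : ℝ≥0∞) ^ 2) ^ (1 / 2 : ℝ) ≤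
      distortion μ ^ (1 / 2 : ℝ) + ((s' - s : ℝ≥0) : ℝ≥0∞) := by
    intro μ hμ
    apply ENNReal.le_of_forall_pos_le_add
    intro ε hε _
    set r : ℝ≥0 := s' + ε with hr
    have hrpos : 0 < r := by positivity
    have hsr : s ≤ r := h.trans (by simp [hr])
    have hlt : W2sq pX (μ.map (fun w => w.2.2)) < (r : ℝ≥0∞) ^ 2 := by
      refine lt_of_le_of_lt hμ.choose_spec.2.2.2.2 ?_
      have : s' ^ 2 < r ^ 2 := by
        apply pow_lt_pow_left₀ _ (by positivity) (by norm_num)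
        simpa [hr] using hε
      exact_mod_cast this
    unfold W2sq at hlt
    simp only [iInf_lt_iff] at hlt
    obtain ⟨c, hcp, hc1, hc2, hcost⟩ := hlt
    have ht : ((1 - s / r : ℝ≥0) : ℝ) = 1 - s / r := by
      rw [NNReal.coe_sub (div_le_one_of_le₀ hsr (by positivity))]; simp
    refine (key_step pX R Rc _ _ μ hμ c hc1 hc2 (1 - s / r) ?_).trans ?_
    · rw [ht]
      have : (1 - (1 - (s : ℝ) / r)) ^ 2 = (((s / r) ^ 2 : ℝ≥0) : ℝ) := by push_cast; ring
      rw [this, ENNReal.ofReal_coe_nnreal]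
      refine (mul_le_mul_right hcost.le _).trans ?_
      have : (s / r) ^ 2 * r ^ 2 = s ^ 2 := by
        rw [← mul_pow, div_mul_cancel₀ _ hrpos.ne']
      exact_mod_cast this.le
    · rw [add_assoc]
      refine add_le_add le_rfl ?_
      have h1 : (∫⁻ xy, ENNReal.ofReal ((xy.1 - xy.2) ^ 2) ∂c) ^ (1 / 2 : ℝ) ≤ r := by
        refine (ENNReal.rpow_le_rpow hcost.le (by norm_num)).trans ?_
        rw [← ENNReal.rpow_two, ← ENNReal.rpow_mul]
        norm_num
      refine (mul_le_mul_right h1 _).trans ?_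
      have : (1 - s / r) * r ≤ s' - s + ε := by
        rw [← NNReal.coe_le_coe]
        push_cast [ht, h]
        have : (r : ℝ) ≠ 0 := by exact_mod_cast hrpos.ne'
        have e : (1 - (s : ℝ) / r) * r = r - s := by field_simp
        rw [e, hr]; push_cast; linarith
      exact_mod_cast this
  rw [← tsub_le_iff_right, one_div, ENNReal.le_rpow_inv_iff (by norm_num)]
  unfold DRP
  refine le_iInf₂ fun μ hμ => ?_
  rw [← ENNReal.le_rpow_inv_iff (by norm_num), ← one_div, tsub_le_iff_right]
  exact main μ hμ

lemma W2_le_distortion (pX : Measure ℝ) (R Rc P : ℝ≥0∞) (μ : Measure (ℝ × ℝ × ℝ))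
    (hμ : DRPfeasible pX W2sq R Rc P μ) :
    DRPfeasible pX W2sq R Rc (distortion μ) μ := by
  obtain ⟨a, b, c, d, e, f⟩ := hμ
  refine ⟨a, b, c, d, e, ?_⟩
  have hM : Measurable (fun p : ℝ × ℝ × ℝ => (p.1, p.2.2)) := by fun_prop
  refine (iInf_le _ (μ.map (fun p => (p.1, p.2.2)))).trans ?_
  refine (iInf_le _ (Measure.isProbabilityMeasure_map hM.aemeasurable)).trans ?_
  refine (iInf_le _ ?_).trans ((iInf_le _ ?_).trans ?_)
  · rw [Measure.map_map measurable_fst hM, ← b]; rfl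
  · rw [Measure.map_map measurable_snd hM]; rfl
  · rw [lintegral_map (by fun_prop) hM]; rfl

lemma DRP_eq_top (pX : Measure ℝ) (R Rc : ℝ≥0∞) {P : ℝ≥0∞}
    (h : DRP pX W2sq R Rc ⊤ < P) :
    DRP pX W2sq R Rc P = DRP pX W2sq R Rc ⊤ := by
  refine le_antisymm ?_ (DRP_antitone pX R Rc le_top)
  apply le_of_forall_gt_imp_ge_of_dense
  intro b hb
  have hb' : DRP pX W2sq R Rc ⊤ < min b P := lt_min hb h
  conv at hb' => lhs; unfold DRP
  simp only [iInf_lt_iff] at hb'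
  obtain ⟨μ, hμ, hlt⟩ := hb'
  have h1 := W2_le_distortion pX R Rc _ μ hμ
  have h2 : DRP pX W2sq R Rc (distortion μ) ≤ distortion μ := iInf₂_le μ h1
  exact ((DRP_antitone pX R Rc (hlt.le.trans (min_le_right _ _))).trans h2).trans
    (hlt.le.trans (min_le_left _ _))

/-- Continuity of `P ↦ D(R, R_c, P | W₂²)` on `[0,∞]` for sources with finite second moment. -/
theorem stmt14 (pX : Measure ℝ) (hpX : IsProbabilityMeasure pX)
    (hm2 : Integrable (fun x => x ^ 2) pX) (R Rc : ℝ≥0∞) :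
    Continuous (fun P : ℝ≥0∞ => DRP pX W2sq R Rc P) := by
  have hc : Continuous (fun s : ℝ≥0 => DRP pX W2sq R Rc ((s : ℝ≥0∞) ^ 2) ^ (1 / 2 : ℝ)) := by
    refine continuous_of_le_add_edist 1 (by simp) fun x y => ?_
    rw [one_mul]
    rcases le_total x y with h | h
    · refine (DRP_lip pX R Rc h).trans (add_le_add le_rfl ?_)
      rw [edist_nndist, NNReal.nndist_eq]
      exact_mod_cast le_max_right _ _
    · refine le_trans ?_ le_self_add
      apply ENNReal.rpow_le_rpow _ (by norm_num)
      apply DRP_antitone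
      gcongr
  have hc2 : Continuous (fun p : ℝ≥0 => DRP pX W2sq R Rc (p : ℝ≥0∞)) := by
    have := (ENNReal.continuous_rpow_const (y := 2)).comp (hc.comp NNReal.continuous_sqrt)
    refine this.congr fun p => ?_
    simp only [Function.comp]
    rw [← ENNReal.rpow_mul]
    norm_num
    congr 1
    exact_mod_cast NNReal.sq_sqrt p
  rw [continuous_iff_continuousAt]
  intro P
  induction P with
  | coe p =>
    exact (ENNReal.isOpenEmbedding_coe.continuousAt_iff (g := fun P => DRP pX W2sq R Rc P)).1
      hc2.continuousAt
  | top =>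
    by_cases hfin : DRP pX W2sq R Rc ⊤ = ⊤
    · have : (fun P : ℝ≥0∞ => DRP pX W2sq R Rc P) = fun _ => ⊤ := by
        ext P
        have := DRP_antitone pX R Rc (le_top (a := P))
        rw [hfin] at this
        exact top_le_iff.1 this
      rw [this]
      exact continuousAt_const
    · have hev : (fun _ : ℝ≥0∞ => DRP pX W2sq R Rc ⊤) =ᶠ[nhds ⊤]
          fun P => DRP pX W2sq R Rc P := by
        filter_upwards [lt_mem_nhds (lt_top_iff_ne_top.2 hfin)] with P hP
        exact (DRP_eq_top pX R Rc hP).symm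
      exact continuousAt_const.congr hev
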